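/- arXiv:2011.12496 — 3 statements merged into one kernel-verified Lean document; each statement's English description precedes it below -/
import Mathlib

section
/- Under the stated setup, let 𝒞 be a connected component of G[S] that contains no linked D-pairs. If S_u is an A-pair in 𝒞 one of whose vertices has no private neighbor, then S_u is a solo pair. -/
open Finset

/-- `m` encodes a perfect matching of the induced subgraph `G[S]`:
every vertex of `S` is matched to a distinct adjacent vertex of `S`. -/
def IsMatchingOn {V : Type*} (G : SimpleGraph V) (S : Finset V) (m : V → V) : Prop :=
  ∀ u ∈ S, m u ∈ S ∧ m u ≠ u ∧ G.Adj u (m u) ∧ m (m u) = u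

/-- `S` is a paired dominating set of `G`: a dominating set such that `G[S]`
has a perfect matching. -/
def IsPDS {V : Type*} (G : SimpleGraph V) (S : Finset V) : Prop :=
  (∀ v : V, v ∉ S → ∃ u ∈ S, G.Adj v u) ∧ ∃ m : V → V, IsMatchingOn G S m

/-- The paired domination number of `G`. -/
noncomputable def gammaPr {V : Type*} (G : SimpleGraph V) : ℕ :=
  sInf {k : ℕ | ∃ S : Finset V, IsPDS G S ∧ S.card = k}

/-- `N_S(x)`, the set of neighbours of `x` inside `S`. -/
def nbrS {V : Type*} [DecidableEq V] (G : SimpleGraph V) [DecidableRel G.Adj]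
    (S : Finset V) (x : V) : Finset V :=
  S.filter (fun u => G.Adj x u)

/-- `λ(S)`: (twice) the number of edges of `G[S]` (each edge counted in both directions). -/
def lambdaS {V : Type*} [DecidableEq V] (G : SimpleGraph V) [DecidableRel G.Adj]
    (S : Finset V) : ℕ :=
  ((S ×ˢ S).filter (fun p => G.Adj p.1 p.2)).card

/-- The private neighbours of `u ∈ S`: vertices outside `S` whose unique
neighbour in `S` is `u`. -/
def privates {V : Type*} [Fintype V] [DecidableEq V] (G : SimpleGraph V) [DecidableRel G.Adj]
    (S : Finset V) (u : V) : Finset V :=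
  Finset.univ.filter (fun x => x ∉ S ∧ nbrS G S x = {u})

/-- `A = {v ∈ S : v and v̄ together have at least two private neighbours}`. -/
def setA {V : Type*} [Fintype V] [DecidableEq V] (G : SimpleGraph V) [DecidableRel G.Adj]
    (S : Finset V) (m : V → V) : Finset V :=
  S.filter (fun v => 2 ≤ (privates G S v).card + (privates G S (m v)).card)

/-- `B = {v ∈ S : v has a private neighbour and v̄ has none}`. -/
def setB {V : Type*} [Fintype V] [DecidableEq V] (G : SimpleGraph V) [DecidableRel G.Adj]
    (S : Finset V) (m : V → V) : Finset V :=
  S.filter (fun v => (privates G S v).Nonempty ∧ privates G S (m v) = ∅)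

/-- `C = {v ∈ S : v̄ ∈ B}`. -/
def setC {V : Type*} [Fintype V] [DecidableEq V] (G : SimpleGraph V) [DecidableRel G.Adj]
    (S : Finset V) (m : V → V) : Finset V :=
  S.filter (fun v => m v ∈ setB G S m)

/-- `D = {v ∈ S : neither v nor v̄ has a private neighbour}`. -/
def setD {V : Type*} [Fintype V] [DecidableEq V] (G : SimpleGraph V) [DecidableRel G.Adj]
    (S : Finset V) (m : V → V) : Finset V :=
  S.filter (fun v => privates G S v = ∅ ∧ privates G S (m v) = ∅)

/-- The weight `f(xu)` of an edge `xu` with `x ∈ V∖S` and `u ∈ S`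
(`0` on non-edges and on pairs not of this form). -/
def fwt {V : Type*} [Fintype V] [DecidableEq V] (G : SimpleGraph V) [DecidableRel G.Adj]
    (S : Finset V) (m : V → V) (x u : V) : ℚ :=
  if x ∈ S ∨ u ∉ S ∨ ¬ G.Adj x u then 0
  else if nbrS G S x = {u} then 1
  else if nbrS G S x ⊆ setA G S m ∨ nbrS G S x ⊆ setB G S m ∪ setC G S m ∨
      nbrS G S x ⊆ setD G S m then
    1 / ((nbrS G S x).card : ℚ)
  else if u ∈ setA G S m then 0
  else if nbrS G S x ∩ setD G S m = ∅ then
    1 / (((nbrS G S x ∩ (setB G S m ∪ setC G S m))).card : ℚ)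
  else if u ∈ setB G S m ∪ setC G S m then 1 / 6
  else (1 - ((nbrS G S x ∩ (setB G S m ∪ setC G S m)).card : ℚ) / 6) /
      ((nbrS G S x ∩ setD G S m).card : ℚ)

/-- `f(S')`: total weight of the edges between `S' ⊆ S` and `V∖S`. -/
def fsum {V : Type*} [Fintype V] [DecidableEq V] (G : SimpleGraph V) [DecidableRel G.Adj]
    (S : Finset V) (m : V → V) (T : Finset V) : ℚ :=
  ∑ u ∈ T, ∑ x ∈ Finset.univ \ S, fwt G S m x u

/-- `C` is (the vertex set of) a connected component of `G[S]`. -/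
def IsComponent {V : Type*} [DecidableEq V] (G : SimpleGraph V) [DecidableRel G.Adj]
    (S C : Finset V) : Prop :=
  C ⊆ S ∧ C.Nonempty ∧ (G.induce (↑C : Set V)).Connected ∧
    ∀ u ∈ C, ∀ v ∈ S, G.Adj u v → v ∈ C

/-- `S_u = {u, m u}` is a `D`-pair. -/
def IsDPair {V : Type*} [Fintype V] [DecidableEq V] (G : SimpleGraph V) [DecidableRel G.Adj]
    (S : Finset V) (m : V → V) (u : V) : Prop :=
  u ∈ setD G S m ∧ m u ∈ setD G S m

/-- `S_u = {u, m u}` is an `A`-pair. -/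
def IsAPair {V : Type*} [Fintype V] [DecidableEq V] (G : SimpleGraph V) [DecidableRel G.Adj]
    (S : Finset V) (m : V → V) (u : V) : Prop :=
  u ∈ setA G S m ∧ m u ∈ setA G S m

/-- `S_u = {u, m u}` is a `BC`-pair. -/
def IsBCPair {V : Type*} [Fintype V] [DecidableEq V] (G : SimpleGraph V) [DecidableRel G.Adj]
    (S : Finset V) (m : V → V) (u : V) : Prop :=
  (u ∈ setB G S m ∧ m u ∈ setC G S m) ∨ (u ∈ setC G S m ∧ m u ∈ setB G S m)

/-- `u` is a leaf of `G[S]`: it has exactly one neighbour in `S`. -/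
def IsLeaf {V : Type*} [DecidableEq V] (G : SimpleGraph V) [DecidableRel G.Adj]
    (S : Finset V) (u : V) : Prop :=
  (nbrS G S u).card = 1

/-- `S_u` is a solo pair: both `u` and `m u` are leaves of `G[S]`. -/
def IsSoloPair {V : Type*} [DecidableEq V] (G : SimpleGraph V) [DecidableRel G.Adj]
    (S : Finset V) (m : V → V) (u : V) : Prop :=
  IsLeaf G S u ∧ IsLeaf G S (m u)

/-- The component `C` of `G[S]` contains no linked `D`-pairs: no edge of `G[S]`
joins vertices of two distinct `D`-pairs. -/
def NoLinkedDPairs {V : Type*} [Fintype V] [DecidableEq V] (G : SimpleGraph V)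
    [DecidableRel G.Adj] (S : Finset V) (m : V → V) (C : Finset V) : Prop :=
  ∀ u ∈ C, ∀ v ∈ C, u ∈ setD G S m → v ∈ setD G S m → v ≠ u → v ≠ m u → ¬ G.Adj u v

/-- `{w₁, w₂}` is a constraint pair of the solo `D`-pair `S_u`. -/
def ConstraintPair {V : Type*} [Fintype V] [DecidableEq V] (G : SimpleGraph V)
    [DecidableRel G.Adj] (S : Finset V) (m : V → V) (u w₁ w₂ : V) : Prop :=
  ∃ x y : V, x ∉ S ∧ y ∉ S ∧ G.Adj u y ∧ G.Adj (m u) x ∧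
    G.Adj x w₁ ∧ G.Adj y w₂ ∧ w₁ ∈ setD G S m ∧ w₂ ∈ setD G S m ∧
    w₁ ≠ w₂ ∧ m w₁ ≠ w₂

/-- The pairs `S_u` and `S_v` are adjacent: some vertex of one is adjacent
to some vertex of the other. -/
def PairAdj {V : Type*} (G : SimpleGraph V) (m : V → V) (u v : V) : Prop :=
  G.Adj u v ∨ G.Adj u (m v) ∨ G.Adj (m u) v ∨ G.Adj (m u) (m v)

/-- The Petersen graph, as the Kneser graph on 2-element subsets of a
5-element set, two subsets being adjacent iff they are disjoint. -/
def petersenGraph : SimpleGraph {s : Finset (Fin 5) // s.card = 2} where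
  Adj a b := Disjoint (a : Finset (Fin 5)) (b : Finset (Fin 5))
  symm := ⟨fun _ _ h => h.symm⟩
  loopless := by
    refine ⟨fun a h => ?_⟩
    rw [disjoint_self] at h
    have h2 := a.2
    rw [h] at h2
    simp at h2

lemma solo_aux {V : Type*} [Fintype V] [DecidableEq V]
    (G : SimpleGraph V) [DecidableRel G.Adj] (S : Finset V) (m : V → V)
    (hcubic : ∀ v : V, G.degree v = 3)
    (hdom : ∀ v : V, v ∉ S → ∃ u ∈ S, G.Adj v u)
    (hmatch : IsMatchingOn G S m)
    (hP1 : ∀ T : Finset V, IsPDS G T → T.card = S.card → lambdaS G S ≤ lambdaS G T)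
    (u : V) (hu : u ∈ S) (hpu : privates G S u = ∅)
    (hpa : 2 ≤ (privates G S (m u)).card) :
    IsLeaf G S u ∧ IsLeaf G S (m u) := by
  obtain ⟨haS, hau, hadj, hmm⟩ := hmatch u hu
  have hpriv : ∀ a x, x ∈ privates G S a ↔ x ∉ S ∧ nbrS G S x = {a} := by
    intro a x; simp [privates]
  have hnbr : ∀ x y, y ∈ nbrS G S x ↔ y ∈ S ∧ G.Adj x y := by
    intro x y; simp [nbrS]
  constructor
  · by_contra hne
    have hmem : m u ∈ nbrS G S u := (hnbr _ _).2 ⟨haS, hadj⟩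
    have hex : ∃ v ∈ nbrS G S u, v ≠ m u := by
      by_contra hno
      push Not at hno
      apply hne
      exact Finset.card_eq_one.2 ⟨m u, Finset.eq_singleton_iff_unique_mem.2 ⟨hmem, hno⟩⟩
    obtain ⟨v, hv, hva⟩ := hex
    obtain ⟨hvS, huv⟩ := (hnbr _ _).1 hv
    obtain ⟨x, hx⟩ : (privates G S (m u)).Nonempty := Finset.card_pos.1 (by omega)
    obtain ⟨hxS, hxn⟩ := (hpriv _ _).1 hx
    have hxonly : ∀ y ∈ S, G.Adj x y → y = m u := by
      intro y hy hxy
      have : y ∈ nbrS G S x := (hnbr _ _).2 ⟨hy, hxy⟩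
      rw [hxn] at this
      simpa using this
    have hxa : G.Adj x (m u) := by
      have : m u ∈ nbrS G S x := by rw [hxn]; simp
      exact ((hnbr _ _).1 this).2
    have hxneu : x ≠ u := fun h => hxS (h ▸ hu)
    have hxnea : x ≠ m u := fun h => hxS (h ▸ haS)
    set T := insert x (S.erase u) with hT
    have hxE : x ∉ S.erase u := fun h => hxS (Finset.mem_of_mem_erase h)
    have hTmem : ∀ z, z ∈ T ↔ z = x ∨ (z ≠ u ∧ z ∈ S) := by
      intro z; simp [hT]
    have hTcard : T.card = S.card := by
      rw [hT, Finset.card_insert_of_notMem hxE, Finset.card_erase_of_mem hu]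
      have := Finset.card_pos.2 ⟨u, hu⟩
      omega
    have hTdom : ∀ z : V, z ∉ T → ∃ y ∈ T, G.Adj z y := by
      intro z hz
      by_cases hzu : z = u
      · exact ⟨m u, (hTmem _).2 (Or.inr ⟨hau, haS⟩), hzu ▸ hadj⟩
      · have hzS : z ∉ S := fun h => hz ((hTmem _).2 (Or.inr ⟨hzu, h⟩))
        by_contra hno
        push Not at hno
        have hall : ∀ y ∈ S, G.Adj z y → y = u := by
          intro y hy hzy
          by_contra hyu
          exact hno y ((hTmem _).2 (Or.inr ⟨hyu, hy⟩)) hzy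
        obtain ⟨y, hy, hzy⟩ := hdom z hzS
        have hyu := hall y hy hzy
        have : z ∈ privates G S u := by
          refine (hpriv _ _).2 ⟨hzS, Finset.eq_singleton_iff_unique_mem.2 ⟨?_, ?_⟩⟩
          · exact (hnbr _ _).2 ⟨hu, hyu ▸ hzy⟩
          · intro w hw
            exact hall w ((hnbr _ _).1 hw).1 ((hnbr _ _).1 hw).2
        rw [hpu] at this
        simp at this
    have hTm : IsMatchingOn G T (fun z => if z = m u then x else if z = x then m u else m z) := by
      intro z hz
      have haT : m u ∈ T := (hTmem _).2 (Or.inr ⟨hau, haS⟩)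
      have hxT : x ∈ T := (hTmem _).2 (Or.inl rfl)
      by_cases hza : z = m u
      · subst hza
        simp [hxnea, hxT, hxa.symm]
      · by_cases hzx : z = x
        · subst hzx
          simp [hxnea, haT, hxa, hxnea.symm]
        · obtain ⟨hzu, hzS⟩ := ((hTmem _).1 hz).resolve_left hzx
          obtain ⟨h1, h2, h3, h4⟩ := hmatch z hzS
          have h5 : m z ≠ u := fun h => hza (by rw [← h, h4])
          have h6 : m z ≠ m u := fun h => hzu (by rw [← h4, h, hmm])
          have h7 : m z ≠ x := fun h => hxS (h ▸ h1)
          simp only [hza, hzx, h6, h7, if_false]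
          exact ⟨(hTmem _).2 (Or.inr ⟨h5, h1⟩), h2, h3, h4⟩
    have hle := hP1 T ⟨hTdom, _, hTm⟩ hTcard
    set E := ((S.erase u ×ˢ S.erase u).filter (fun p => G.Adj p.1 p.2)) with hE
    have hup : lambdaS G T ≤ E.card + 2 := by
      have hsub : (T ×ˢ T).filter (fun p => G.Adj p.1 p.2) ⊆
          insert (x, m u) (insert (m u, x) E) := by
        rintro ⟨p, q⟩ hpq
        simp only [Finset.mem_filter, Finset.mem_product, hTmem] at hpq
        obtain ⟨⟨hp, hq⟩, hadj'⟩ := hpq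
        simp only [hE, Finset.mem_insert, Finset.mem_filter, Finset.mem_product,
          Finset.mem_erase, Prod.mk.injEq]
        rcases hp with rfl | hp
        · rcases hq with rfl | hq
          · exact absurd hadj' (G.irrefl)
          · exact Or.inl ⟨rfl, hxonly q hq.2 hadj'⟩
        · rcases hq with rfl | hq
          · exact Or.inr (Or.inl ⟨hxonly p hp.2 hadj'.symm, rfl⟩)
          · exact Or.inr (Or.inr ⟨⟨hp, hq⟩, hadj'⟩)
      have h1 := Finset.card_le_card hsub
      have h2 := Finset.card_insert_le (x, m u) (insert (m u, x) E)
      have h3 := Finset.card_insert_le (m u, x) E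
      unfold lambdaS
      omega
    have hlow : E.card + 3 ≤ lambdaS G S := by
      have hsub : insert (u, m u) (insert (m u, u) (insert (u, v) E)) ⊆
          (S ×ˢ S).filter (fun p => G.Adj p.1 p.2) := by
        rintro ⟨p, q⟩ hpq
        simp only [hE, Finset.mem_insert, Finset.mem_filter, Finset.mem_product,
          Finset.mem_erase, Prod.mk.injEq] at hpq ⊢
        rcases hpq with ⟨rfl, rfl⟩ | ⟨rfl, rfl⟩ | ⟨rfl, rfl⟩ | h
        · exact ⟨⟨hu, haS⟩, hadj⟩
        · exact ⟨⟨haS, hu⟩, hadj.symm⟩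
        · exact ⟨⟨hu, hvS⟩, huv⟩
        · exact ⟨⟨h.1.1.2, h.1.2.2⟩, h.2⟩
      have h1 := Finset.card_le_card hsub
      rw [Finset.card_insert_of_notMem, Finset.card_insert_of_notMem,
        Finset.card_insert_of_notMem] at h1
      · exact h1
      · simp [hE]
      · simp [hE, hau]
      · simp [hE, hau.symm, hva.symm]
    omega
  · have hmem : u ∈ nbrS G S (m u) := (hnbr _ _).2 ⟨hu, hadj.symm⟩
    have hdisj : Disjoint (nbrS G S (m u)) (privates G S (m u)) := by
      rw [Finset.disjoint_left]
      intro z h1 h2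
      exact ((hpriv _ _).1 h2).1 ((hnbr _ _).1 h1).1
    have hsub : nbrS G S (m u) ∪ privates G S (m u) ⊆ G.neighborFinset (m u) := by
      intro z hz
      rw [SimpleGraph.mem_neighborFinset]
      rcases Finset.mem_union.1 hz with h | h
      · exact ((hnbr _ _).1 h).2
      · have h2 : m u ∈ nbrS G S z := by rw [((hpriv _ _).1 h).2]; simp
        exact ((hnbr _ _).1 h2).2.symm
    have h1 := Finset.card_le_card hsub
    rw [Finset.card_union_of_disjoint hdisj, SimpleGraph.card_neighborFinset_eq_degree,
      hcubic] at h1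
    have h2 := Finset.card_pos.2 ⟨u, hmem⟩
    unfold IsLeaf
    omega

theorem A_pair_with_vertex_without_private_is_solo {V : Type*} [Fintype V] [DecidableEq V]
    (G : SimpleGraph V) [DecidableRel G.Adj] (S : Finset V) (m : V → V)
    (hconn : G.Connected)
    (hcubic : ∀ v : V, G.degree v = 3)
    (hdom : ∀ v : V, v ∉ S → ∃ u ∈ S, G.Adj v u)
    (hmatch : IsMatchingOn G S m)
    (hmincard : ∀ T : Finset V, IsPDS G T → S.card ≤ T.card)
    (hP1 : ∀ T : Finset V, IsPDS G T → T.card = S.card → lambdaS G S ≤ lambdaS G T)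
    (hP2 : ∀ (T : Finset V) (m' : V → V),
        (∀ v : V, v ∉ T → ∃ u ∈ T, G.Adj v u) → IsMatchingOn G T m' →
        T.card = S.card → lambdaS G T = lambdaS G S →
        (setA G S m ∪ setB G S m).card ≤ (setA G T m' ∪ setB G T m').card) :
    ∀ C : Finset V, IsComponent G S C → NoLinkedDPairs G S m C →
      ∀ u ∈ C, IsAPair G S m u →
        (privates G S u = ∅ ∨ privates G S (m u) = ∅) →
        IsSoloPair G S m u := by
  intro C hC _ u huC hA hp
  have hu : u ∈ S := hC.1 huC
  obtain ⟨haS, hau, hadj, hmm⟩ := hmatch u hu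
  have h2 : 2 ≤ (privates G S u).card + (privates G S (m u)).card :=
    (Finset.mem_filter.1 hA.1).2
  rcases hp with hp | hp
  · rw [hp] at h2
    exact solo_aux G S m hcubic hdom hmatch hP1 u hu hp (by simpa using h2)
  · rw [hp] at h2
    have h := solo_aux G S m hcubic hdom hmatch hP1 (m u) haS hp (by rw [hmm]; simpa using h2)
    rw [hmm] at h
    exact ⟨h.2, h.1⟩
end

section
/- Under the stated setup, there do not exist three pairwise distinct D-pairs S_u, S_v, S_w such that uv ∈ E(G) and uw ∈ E(G). -/
open Finset

lemma lambdaS_insert {V : Type*} [DecidableEq V] (G : SimpleGraph V) [DecidableRel G.Adj]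
    (R : Finset V) (x : V) (hx : x ∉ R) :
    lambdaS G (insert x R) = lambdaS G R + 2 * (nbrS G R x).card := by
  have key : ∀ S : Finset V, lambdaS G S = ∑ a ∈ S, ∑ b ∈ S, if G.Adj a b then 1 else 0 := by
    intro S
    unfold lambdaS
    rw [Finset.card_filter, Finset.sum_product]
  have h2 : ∑ a ∈ R, (if G.Adj a x then 1 else 0) = (nbrS G R x).card := by
    unfold nbrS
    rw [Finset.card_filter]
    exact Finset.sum_congr rfl (fun a _ => by simp only [G.adj_comm])
  have h3 : ∑ a ∈ R, (if G.Adj x a then 1 else 0) = (nbrS G R x).card := by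
    unfold nbrS
    rw [Finset.card_filter]
  rw [key, key, Finset.sum_insert hx, Finset.sum_insert hx]
  simp only [Finset.sum_insert hx, Finset.sum_add_distrib]
  rw [h2, h3]
  simp
  omega

theorem no_D_pair_adjacent_to_two_D_pairs {V : Type*} [Fintype V] [DecidableEq V]
    (G : SimpleGraph V) [DecidableRel G.Adj] (S : Finset V) (m : V → V)
    (hconn : G.Connected)
    (hcubic : ∀ v : V, G.degree v = 3)
    (hdom : ∀ v : V, v ∉ S → ∃ u ∈ S, G.Adj v u)
    (hmatch : IsMatchingOn G S m)
    (hmincard : ∀ T : Finset V, IsPDS G T → S.card ≤ T.card)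
    (hP1 : ∀ T : Finset V, IsPDS G T → T.card = S.card → lambdaS G S ≤ lambdaS G T)
    (hP2 : ∀ (T : Finset V) (m' : V → V),
        (∀ v : V, v ∉ T → ∃ u ∈ T, G.Adj v u) → IsMatchingOn G T m' →
        T.card = S.card → lambdaS G T = lambdaS G S →
        (setA G S m ∪ setB G S m).card ≤ (setA G T m' ∪ setB G T m').card) :
    ¬ ∃ u v w : V, IsDPair G S m u ∧ IsDPair G S m v ∧ IsDPair G S m w ∧
      v ≠ u ∧ v ≠ m u ∧ w ≠ u ∧ w ≠ m u ∧ w ≠ v ∧ w ≠ m v ∧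
      G.Adj u v ∧ G.Adj u w := by
  rintro ⟨u, v, w, ⟨hDu, -⟩, ⟨hDv, -⟩, ⟨hDw, -⟩, hvu, hvmu, hwu, hwmu, hwv, hwmv, huv, huw⟩
  have huS : u ∈ S := (Finset.mem_filter.1 hDu).1
  have hvS : v ∈ S := (Finset.mem_filter.1 hDv).1
  have hwS : w ∈ S := (Finset.mem_filter.1 hDw).1
  have hpv : privates G S (m v) = ∅ := (Finset.mem_filter.1 hDv).2.2
  obtain ⟨hmuS, hmune, hmuadj, hmmu⟩ := hmatch u huS
  obtain ⟨hmvS, hmvne, hmvadj, hmmv⟩ := hmatch v hvS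
  -- the neighbours of `u`
  have h3 : ({m u, v, w} : Finset V).card = 3 := by
    rw [Finset.card_eq_three]
    exact ⟨m u, v, w, fun h => hvmu h.symm, fun h => hwmu h.symm, fun h => hwv h.symm, rfl⟩
  have hNu : ({m u, v, w} : Finset V) = G.neighborFinset u := by
    apply Finset.eq_of_subset_of_card_le
    · intro z hz
      simp only [Finset.mem_insert, Finset.mem_singleton] at hz
      rw [SimpleGraph.mem_neighborFinset]
      rcases hz with rfl | rfl | rfl <;> assumption
    · rw [SimpleGraph.card_neighborFinset_eq_degree, hcubic, h3]
  have hNuS : ∀ z, G.Adj u z → z ∈ S := by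
    intro z hz
    have : z ∈ ({m u, v, w} : Finset V) := by
      rw [hNu, SimpleGraph.mem_neighborFinset]; exact hz
    simp only [Finset.mem_insert, Finset.mem_singleton] at this
    rcases this with rfl | rfl | rfl <;> assumption
  have hmuu : m v ≠ m u := fun h => hvu (by rw [← hmmv, h, hmmu])
  have hmvu : m v ≠ u := fun h => hvmu (by rw [← h, hmmv])
  -- every outside neighbour of `m u` has three neighbours in `S`
  have hx3 : ∀ x, x ∉ S → G.Adj x (m u) → 3 ≤ (nbrS G S x).card := by
    intro x hxS hxa
    have hxR : x ∉ S.erase u := fun h => hxS (Finset.mem_of_mem_erase h)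
    have hnxu : ¬ G.Adj x u := fun h => hxS (hNuS x h.symm)
    have hxne : ∀ z ∈ S, z ≠ x := fun z hz h => hxS (h ▸ hz)
    have hcard : (insert x (S.erase u)).card = S.card := by
      rw [Finset.card_insert_of_notMem hxR, Finset.card_erase_add_one huS]
    have hpds : IsPDS G (insert x (S.erase u)) := by
      refine ⟨?_, fun z => if z = x then m u else if z = m u then x else m z, ?_⟩
      · intro y hy
        rw [Finset.mem_insert, Finset.mem_erase, not_or] at hy
        by_cases hyu : y = u
        · subst hyu
          exact ⟨m y, by simp [hmune, hmuS], hmuadj⟩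
        · have hyS : y ∉ S := fun h => hy.2 ⟨hyu, h⟩
          obtain ⟨t, htS, hyt⟩ := hdom y hyS
          have htu : t ≠ u := by
            rintro rfl
            exact hyS (hNuS y hyt.symm)
          exact ⟨t, by simp [htu, htS], hyt⟩
      · intro z hz
        rw [Finset.mem_insert, Finset.mem_erase] at hz
        have hmux := hxne _ hmuS
        by_cases hzx : z = x
        · subst hzx
          simp [hmune, hmuS, hmux, hxa]
        · by_cases hzm : z = m u
          · subst hzm
            simp [hmux, hmux.symm, hxa.symm]
          · obtain ⟨hzu, hzS⟩ := hz.resolve_left hzx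
            obtain ⟨a1, a2, a3, a4⟩ := hmatch z hzS
            have b1 : m z ≠ x := hxne _ a1
            have b2 : m z ≠ m u := fun h => hzu (by rw [← a4, h, hmmu])
            have b3 : m z ≠ u := fun h => hzm (by rw [← h, a4])
            simp [hzx, hzm, a1, a2, a3, a4, b1, b2, b3]
    have hl := hP1 _ hpds hcard
    have hSe : insert u (S.erase u) = S := Finset.insert_erase huS
    have hl1 := lambdaS_insert G (S.erase u) u (Finset.notMem_erase u S)
    rw [hSe] at hl1
    rw [lambdaS_insert G _ x hxR, hl1] at hl
    have e1 : (nbrS G (S.erase u) u).card = 3 := by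
      rw [← h3, hNu]
      congr 1
      ext z
      simp only [nbrS, Finset.mem_filter, Finset.mem_erase, SimpleGraph.mem_neighborFinset]
      exact ⟨fun h => h.2, fun h => ⟨⟨fun e => G.ne_of_adj h e.symm, hNuS z h⟩, h⟩⟩
    have e2 : (nbrS G (S.erase u) x).card ≤ (nbrS G S x).card :=
      Finset.card_le_card (Finset.filter_subset_filter _ (Finset.erase_subset _ _))
    omega
  -- hence `m u` and `m v` can be removed
  have hpds : IsPDS G ((S.erase (m u)).erase (m v)) := by
    have huT : u ∈ (S.erase (m u)).erase (m v) := by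
      simp [hmvu.symm, hmune.symm, huS]
    have hvT : v ∈ (S.erase (m u)).erase (m v) := by
      simp [hmvne.symm, hvmu, hvS]
    refine ⟨?_, fun z => if z = u then v else if z = v then u else m z, ?_⟩
    · intro y hy
      by_cases hyu : y = m u
      · exact ⟨u, huT, by rw [hyu]; exact hmuadj.symm⟩
      by_cases hyv : y = m v
      · exact ⟨v, hvT, by rw [hyv]; exact hmvadj.symm⟩
      have hyS : y ∉ S := fun h => hy (by simp [hyu, hyv, h])
      by_contra hcon
      push Not at hcon
      have hsub : nbrS G S y ⊆ {m u, m v} := by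
        intro t ht
        simp only [nbrS, Finset.mem_filter] at ht
        by_contra htn
        simp only [Finset.mem_insert, Finset.mem_singleton, not_or] at htn
        exact hcon t (by simp [htn.1, htn.2, ht.1]) ht.2
      by_cases hya : G.Adj y (m u)
      · have := hx3 y hyS hya
        have h2 := (Finset.card_le_card hsub).trans Finset.card_le_two
        omega
      · have hsub2 : ∀ t ∈ nbrS G S y, t = m v := by
          intro t ht
          have h1 := hsub ht
          simp only [nbrS, Finset.mem_filter] at ht
          simp only [Finset.mem_insert, Finset.mem_singleton] at h1
          rcases h1 with rfl | h1
          · exact absurd ht.2 hya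
          · exact h1
        obtain ⟨t, htS, hyt⟩ := hdom y hyS
        have htN : t ∈ nbrS G S y := by simp [nbrS, htS, hyt]
        have hpriv : y ∈ privates G S (m v) := by
          simp only [privates, Finset.mem_filter, Finset.mem_univ, true_and]
          exact ⟨hyS, Finset.eq_singleton_iff_unique_mem.2 ⟨hsub2 t htN ▸ htN, hsub2⟩⟩
        rw [hpv] at hpriv
        simp at hpriv
    · intro z hz
      by_cases hzu : z = u
      · subst hzu
        simp only [if_true, if_neg hvu]
        exact ⟨hvT, hvu, huv, trivial⟩
      by_cases hzv : z = v
      · subst hzv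
        simp only [if_true, if_neg hzu]
        exact ⟨huT, fun h => hzu h.symm, huv.symm, trivial⟩
      simp only [Finset.mem_erase] at hz
      obtain ⟨hz1, hz2, hzS⟩ := hz
      obtain ⟨a1, a2, a3, a4⟩ := hmatch z hzS
      have b1 : m z ≠ m u := fun h => hzu (by rw [← a4, h, hmmu])
      have b2 : m z ≠ m v := fun h => hzv (by rw [← a4, h, hmmv])
      have b3 : m z ≠ u := fun h => hz2 (by rw [← h, a4])
      have b4 : m z ≠ v := fun h => hz1 (by rw [← h, a4])
      simp [hzu, hzv, a1, a2, a3, a4, b1, b2, b3, b4]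
  have hle := hmincard _ hpds
  have hlt : ((S.erase (m u)).erase (m v)).card < S.card :=
    (Finset.card_le_card (Finset.erase_subset _ _)).trans_lt (Finset.card_erase_lt_of_mem hmuS)
  omega
end

section
/- Under the stated setup, every BC-pair is adjacent in G[S] to at most one other pair, every A-pair is adjacent in G[S] to at most two other pairs, and consequently every connected component of G[S] contains at most two BC-pairs. -/
open Finset

section helpers

variable {V : Type*} [Fintype V] [DecidableEq V] (G : SimpleGraph V) [DecidableRel G.Adj]
  (S : Finset V) (m : V → V)

/-- neighbours of `u` in `S` other than its partner -/
def extN (u : V) : Finset V := (nbrS G S u).erase (m u)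

theorem mem_extN (u v : V) : v ∈ extN G S m u ↔ v ≠ m u ∧ v ∈ S ∧ G.Adj u v := by
  simp [extN, nbrS]

theorem mem_privates (u x : V) :
    x ∈ privates G S u ↔ x ∉ S ∧ ∀ w, (w ∈ S ∧ G.Adj x w) ↔ w = u := by
  simp [privates, nbrS, Finset.ext_iff]

theorem ext_priv_card (hcubic : ∀ v : V, G.degree v = 3) (hm : IsMatchingOn G S m)
    (u : V) (hu : u ∈ S) : (privates G S u).card + (extN G S m u).card ≤ 2 := by
  have h1 : (privates G S u).card + (extN G S m u).card
      = (privates G S u ∪ extN G S m u).card := by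
    rw [Finset.card_union_of_disjoint]
    rw [Finset.disjoint_left]
    intro x hx hx'
    rw [mem_privates] at hx
    rw [mem_extN] at hx'
    exact hx.1 hx'.2.1
  have h2 : privates G S u ∪ extN G S m u ⊆ (G.neighborFinset u).erase (m u) := by
    intro x hx
    rw [Finset.mem_union, mem_privates, mem_extN] at hx
    rw [Finset.mem_erase, SimpleGraph.mem_neighborFinset]
    rcases hx with ⟨h, h'⟩ | h
    · refine ⟨?_, ((h' u).2 rfl).2.symm⟩
      rintro rfl
      exact h (hm u hu).1
    · exact ⟨h.1, h.2.2⟩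
  have h3 := Finset.card_le_card h2
  rw [Finset.card_erase_of_mem (by
    rw [SimpleGraph.mem_neighborFinset]; exact (hm u hu).2.2.1),
    SimpleGraph.card_neighborFinset_eq_degree, hcubic] at h3
  omega

theorem full_nbr (hcubic : ∀ v : V, G.degree v = 3) (hm : IsMatchingOn G S m)
    (u : V) (hu : u ∈ S) (h : (extN G S m u).card = 2) (v : V) (hv : G.Adj u v) : v ∈ S := by
  have h2 : extN G S m u ⊆ (G.neighborFinset u).erase (m u) := by
    intro x hx
    rw [mem_extN] at hx
    rw [Finset.mem_erase, SimpleGraph.mem_neighborFinset]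
    exact ⟨hx.1, hx.2.2⟩
  have h3 := Finset.eq_of_subset_of_card_le h2 (by
    rw [Finset.card_erase_of_mem (by
      rw [SimpleGraph.mem_neighborFinset]; exact (hm u hu).2.2.1),
      SimpleGraph.card_neighborFinset_eq_degree, hcubic, h])
  by_cases hvm : v = m u
  · rw [hvm]; exact (hm u hu).1
  · have : v ∈ extN G S m u := by
      rw [h3, Finset.mem_erase, SimpleGraph.mem_neighborFinset]
      exact ⟨hvm, hv⟩
    rw [mem_extN] at this
    exact this.2.1

theorem D_aux (hcubic : ∀ v : V, G.degree v = 3)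
    (hdom : ∀ v : V, v ∉ S → ∃ u ∈ S, G.Adj v u)
    (hm : IsMatchingOn G S m)
    (hmincard : ∀ T : Finset V, IsPDS G T → S.card ≤ T.card)
    (u : V) (hu : u ∈ S) (hp : privates G S (m u) = ∅)
    (h : (extN G S m u).card = 2) (h' : (extN G S m (m u)).Nonempty) : False := by
  obtain ⟨hmu, hne, hadj, hmm⟩ := hm u hu
  obtain ⟨a, ha⟩ : (extN G S m u).Nonempty := by
    rw [← Finset.card_pos]; omega
  obtain ⟨b, hb⟩ := h'
  rw [mem_extN] at ha hb
  rw [hmm] at hb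
  have hT : IsPDS G ((S.erase u).erase (m u)) := by
    refine ⟨?_, m, ?_⟩
    · intro v hv
      by_cases hvu : v = u
      · subst hvu
        refine ⟨a, ?_, ha.2.2⟩
        simp only [Finset.mem_erase]
        exact ⟨ha.1, ha.2.2.ne', ha.2.1⟩
      by_cases hvm : v = m u
      · subst hvm
        refine ⟨b, ?_, hb.2.2⟩
        simp only [Finset.mem_erase]
        exact ⟨hb.2.2.ne', hb.1, hb.2.1⟩
      have hvS : v ∉ S := by
        intro hh; apply hv; simp only [Finset.mem_erase]; exact ⟨hvm, hvu, hh⟩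
      have hnu : ¬ G.Adj v u := fun hh => hvS (full_nbr G S m hcubic hm u hu h v hh.symm)
      obtain ⟨w, hw, hvw⟩ := hdom v hvS
      have hwu : w ≠ u := by rintro rfl; exact hnu hvw
      by_cases hwm : w = m u
      · by_contra hcon
        have : v ∈ privates G S (m u) := by
          rw [mem_privates]
          refine ⟨hvS, fun t => ⟨?_, ?_⟩⟩
          · rintro ⟨ht, hvt⟩
            by_contra htm
            apply hcon
            refine ⟨t, ?_, hvt⟩
            simp only [Finset.mem_erase]
            refine ⟨htm, ?_, ht⟩
            rintro rfl; exact hnu hvt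
          · rintro rfl
            rw [← hwm]; exact ⟨hw, hvw⟩
        rw [hp] at this
        simp at this
      · refine ⟨w, ?_, hvw⟩
        simp only [Finset.mem_erase]
        exact ⟨hwm, hwu, hw⟩
    · intro t ht
      simp only [Finset.mem_erase] at ht ⊢
      obtain ⟨h1, h2, h3, h4⟩ := hm t ht.2.2
      refine ⟨⟨?_, ?_, h1⟩, h2, h3, h4⟩
      · intro hh
        apply ht.2.1
        rw [← h4, hh, hmm]
      · intro hh
        apply ht.1
        rw [← h4, hh]
  have := hmincard _ hT
  have h2 : ((S.erase u).erase (m u)).card < S.card :=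
    lt_of_le_of_lt (Finset.card_le_card (Finset.erase_subset _ _)) (Finset.card_erase_lt_of_mem hu)
  omega

theorem BC_aux (hdom : ∀ v : V, v ∉ S → ∃ u ∈ S, G.Adj v u)
    (hm : IsMatchingOn G S m)
    (hP1 : ∀ T : Finset V, IsPDS G T → T.card = S.card → lambdaS G S ≤ lambdaS G T)
    (u : V) (hu : u ∈ S) (hp : (privates G S u).Nonempty) (hq : privates G S (m u) = ∅) :
    extN G S m (m u) = ∅ := by
  by_contra hne0
  obtain ⟨a, ha⟩ := Finset.nonempty_iff_ne_empty.2 hne0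
  obtain ⟨x, hx⟩ := hp
  obtain ⟨hmu, hne, hadj, hmm⟩ := hm u hu
  rw [mem_extN, hmm] at ha
  rw [mem_privates] at hx
  obtain ⟨hxS, hx⟩ := hx
  have hxu : G.Adj x u := ((hx u).2 rfl).2
  have hxn : ∀ w ∈ S, G.Adj x w → w = u := fun w h1 h2 => (hx w).1 ⟨h1, h2⟩
  have hT : IsPDS G (insert x (S.erase (m u))) := by
    refine ⟨?_, fun y => if y = u then x else if y = x then u else m y, ?_⟩
    · intro v hv
      simp only [Finset.mem_insert, Finset.mem_erase, not_or, not_and] at hv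
      by_cases hvm : v = m u
      · subst hvm
        refine ⟨u, ?_, hadj.symm⟩
        simp only [Finset.mem_insert, Finset.mem_erase]
        exact Or.inr ⟨hne.symm, hu⟩
      have hvS := hv.2 hvm
      by_contra hcon
      have hall : ∀ w ∈ S, G.Adj v w → w = m u := by
        intro w hw hvw
        by_contra hwm
        apply hcon
        refine ⟨w, ?_, hvw⟩
        simp only [Finset.mem_insert, Finset.mem_erase]
        exact Or.inr ⟨hwm, hw⟩
      have : v ∈ privates G S (m u) := by
        rw [mem_privates]
        refine ⟨hvS, fun t => ⟨fun h => hall t h.1 h.2, ?_⟩⟩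
        rintro rfl
        obtain ⟨w, hw, hvw⟩ := hdom v hvS
        have := hall w hw hvw
        subst this
        exact ⟨hw, hvw⟩
      rw [hq] at this
      simp at this
    · intro t ht
      have hxu' : x ≠ u := hxu.ne
      by_cases htu : t = u
      · subst htu
        simp only [if_true, if_neg hxu']
        refine ⟨Finset.mem_insert_self _ _, hxu', hxu.symm, trivial⟩
      by_cases htx : t = x
      · subst htx
        simp only [if_true, if_neg hxu']
        refine ⟨?_, Ne.symm hxu', hxu, trivial⟩
        simp only [Finset.mem_insert, Finset.mem_erase]
        exact Or.inr ⟨hne.symm, hu⟩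
      simp only [Finset.mem_insert, Finset.mem_erase, htx, false_or] at ht
      obtain ⟨h1, h2, h3, h4⟩ := hm t ht.2
      have k1 : m t ≠ u := by
        intro hh; apply ht.1; rw [← h4, hh]
      have k2 : m t ≠ x := by
        intro hh; apply hxS; rw [← hh]; exact h1
      have k3 : m t ≠ m u := by
        intro hh; apply htu; rw [← h4, hh, hmm]
      simp only [if_neg htu, if_neg htx, if_neg k1, if_neg k2]
      refine ⟨?_, h2, h3, h4⟩
      simp only [Finset.mem_insert, Finset.mem_erase]
      exact Or.inr ⟨k3, h1⟩
  have hcard : (insert x (S.erase (m u))).card = S.card := by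
    rw [Finset.card_insert_of_notMem (by simp [hxS]), Finset.card_erase_of_mem hmu]
    have : 0 < S.card := Finset.card_pos.2 ⟨u, hu⟩
    omega
  have hle := hP1 _ hT hcard
  unfold lambdaS at hle
  set E := (S ×ˢ S).filter (fun p => G.Adj p.1 p.2) with hE
  let Q : Finset (V × V) := {(u, m u), (m u, u), (m u, a), (a, m u)}
  have hQc : Q.card = 4 := by
    have h1 := hne
    have h2 := ha.1
    have h3 : a ≠ m u := ha.2.2.ne'
    simp only [Q]
    rw [Finset.card_insert_of_notMem, Finset.card_insert_of_notMem,
      Finset.card_insert_of_notMem, Finset.card_singleton]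
    · simp [h3]
    · simp [h2.symm, h3.symm]
    · simp [h1.symm, h2.symm]
  have hQE : Q ⊆ E := by
    intro p hp
    simp only [Q, Finset.mem_insert, Finset.mem_singleton] at hp
    simp only [hE, Finset.mem_filter, Finset.mem_product]
    rcases hp with rfl | rfl | rfl | rfl
    · exact ⟨⟨hu, hmu⟩, hadj⟩
    · exact ⟨⟨hmu, hu⟩, hadj.symm⟩
    · exact ⟨⟨hmu, ha.2.1⟩, ha.2.2⟩
    · exact ⟨⟨ha.2.1, hmu⟩, ha.2.2.symm⟩
  have hsub : ((insert x (S.erase (m u))) ×ˢ (insert x (S.erase (m u)))).filter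
      (fun p => G.Adj p.1 p.2) ⊆ insert (u, x) (insert (x, u) (E \ Q)) := by
    rintro ⟨p, q⟩ hpq
    simp only [Finset.mem_filter, Finset.mem_product, Finset.mem_insert, Finset.mem_erase] at hpq
    simp only [Q, hE, Finset.mem_insert, Finset.mem_sdiff, Finset.mem_filter, Finset.mem_product,
      Prod.mk.injEq, Finset.mem_singleton]
    obtain ⟨⟨hp, hq⟩, hpq⟩ := hpq
    rcases hp with rfl | ⟨hp1, hp2⟩
    · rcases hq with rfl | ⟨hq1, hq2⟩
      · exact absurd hpq (G.irrefl)
      · exact Or.inr (Or.inl ⟨rfl, hxn q hq2 hpq⟩)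
    · rcases hq with rfl | ⟨hq1, hq2⟩
      · exact Or.inl ⟨hxn p hp2 hpq.symm, rfl⟩
      · refine Or.inr (Or.inr ⟨⟨⟨hp2, hq2⟩, hpq⟩, ?_⟩)
        simp [hp1, hq1]
  have h1 := Finset.card_le_card hsub
  have h2 := Finset.card_insert_le (u, x) (insert (x, u) (E \ Q))
  have h3 := Finset.card_insert_le (x, u) (E \ Q)
  have h4 := Finset.card_sdiff_add_card_eq_card hQE
  omega

theorem mem_ext_of_pairAdj (hm : IsMatchingOn G S m) (u v : V) (hu : u ∈ S) (hv : v ∈ S)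
    (h1 : v ≠ u) (h2 : v ≠ m u) (h : PairAdj G m u v) :
    ∃ v' ∈ extN G S m u ∪ extN G S m (m u), v' = v ∨ v' = m v := by
  obtain ⟨-, -, -, hmm⟩ := hm u hu
  obtain ⟨hmv, -, -, hmmv⟩ := hm v hv
  have h3 : m v ≠ u := by intro hh; apply h2; rw [← hmmv, hh]
  have h4 : m v ≠ m u := by intro hh; apply h1; rw [← hmmv, hh, hmm]
  simp only [Finset.mem_union, mem_extN, hmm]
  rcases h with h | h | h | h
  · exact ⟨v, Or.inl ⟨h2, hv, h⟩, Or.inl rfl⟩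
  · exact ⟨m v, Or.inl ⟨h4, hmv, h⟩, Or.inr rfl⟩
  · exact ⟨v, Or.inr ⟨h1, hv, h⟩, Or.inl rfl⟩
  · exact ⟨m v, Or.inr ⟨h3, hmv, h⟩, Or.inr rfl⟩

theorem rep_ne (hm : IsMatchingOn G S m) (v w v' w' : V) (hv : v ∈ S) (hw : w ∈ S)
    (h1 : w ≠ v) (h2 : w ≠ m v) (hv' : v' = v ∨ v' = m v) (hw' : w' = w ∨ w' = m w) :
    v' ≠ w' := by
  have e1 := (hm v hv).2.2.2
  have e2 := (hm w hw).2.2.2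
  rintro rfl
  rcases hv' with rfl | rfl <;> rcases hw' with h | h
  · exact h1 h.symm
  · exact h2 (by rw [h, e2])
  · exact h2 h.symm
  · exact h1 (by rw [← e2, ← h, e1])

theorem ext_BC (hcubic : ∀ v : V, G.degree v = 3)
    (hdom : ∀ v : V, v ∉ S → ∃ u ∈ S, G.Adj v u)
    (hm : IsMatchingOn G S m)
    (hP1 : ∀ T : Finset V, IsPDS G T → T.card = S.card → lambdaS G S ≤ lambdaS G T)
    (u : V) (hu : u ∈ S) (h : IsBCPair G S m u) :
    (extN G S m u ∪ extN G S m (m u)).card ≤ 1 := by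
  obtain ⟨hmu, hne, hadj, hmm⟩ := hm u hu
  rcases h with ⟨h, -⟩ | ⟨-, h⟩
  · simp only [setB, Finset.mem_filter] at h
    rw [BC_aux G S m hdom hm hP1 u hu h.2.1 h.2.2, Finset.union_empty]
    have := ext_priv_card G S m hcubic hm u hu
    have := Finset.card_pos.2 h.2.1
    omega
  · simp only [setB, Finset.mem_filter] at h
    have h0 := BC_aux G S m hdom hm hP1 (m u) hmu h.2.1 h.2.2
    rw [hmm] at h0
    rw [h0, Finset.empty_union]
    have := ext_priv_card G S m hcubic hm (m u) hmu
    have := Finset.card_pos.2 h.2.1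
    omega

theorem ext_all (hcubic : ∀ v : V, G.degree v = 3)
    (hdom : ∀ v : V, v ∉ S → ∃ u ∈ S, G.Adj v u)
    (hm : IsMatchingOn G S m)
    (hmincard : ∀ T : Finset V, IsPDS G T → S.card ≤ T.card)
    (hP1 : ∀ T : Finset V, IsPDS G T → T.card = S.card → lambdaS G S ≤ lambdaS G T)
    (u : V) (hu : u ∈ S) :
    (extN G S m u ∪ extN G S m (m u)).card ≤ 2 := by
  obtain ⟨hmu, hne, hadj, hmm⟩ := hm u hu
  have p1 := ext_priv_card G S m hcubic hm u hu
  have p2 := ext_priv_card G S m hcubic hm (m u) hmu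
  have hun := Finset.card_union_le (extN G S m u) (extN G S m (m u))
  by_contra hcon
  by_cases q1 : privates G S u = ∅
  · by_cases q2 : privates G S (m u) = ∅
    · have c : (extN G S m u).card = 2 ∨ (extN G S m (m u)).card = 2 := by omega
      rcases c with c | c
      · exact D_aux G S m hcubic hdom hm hmincard u hu q2 c (by
          rw [← Finset.card_pos]; omega)
      · exact D_aux G S m hcubic hdom hm hmincard (m u) hmu (by rw [hmm]; exact q1) c (by
          rw [← Finset.card_pos, hmm]; omega)
    · have h0 := BC_aux G S m hdom hm hP1 (m u) hmu (Finset.nonempty_iff_ne_empty.2 q2)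
        (by rw [hmm]; exact q1)
      rw [hmm] at h0
      rw [h0, Finset.empty_union] at hcon
      omega
  · by_cases q2 : privates G S (m u) = ∅
    · have h0 := BC_aux G S m hdom hm hP1 u hu (Finset.nonempty_iff_ne_empty.2 q1) q2
      rw [h0, Finset.union_empty] at hcon
      omega
    · have := Finset.card_pos.2 (Finset.nonempty_iff_ne_empty.2 q1)
      have := Finset.card_pos.2 (Finset.nonempty_iff_ne_empty.2 q2)
      omega

theorem no_two (hm : IsMatchingOn G S m) (u : V) (hu : u ∈ S)
    (hc : (extN G S m u ∪ extN G S m (m u)).card ≤ 1) :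
    ¬ ∃ v w : V, v ∈ S ∧ w ∈ S ∧
        v ≠ u ∧ v ≠ m u ∧ w ≠ u ∧ w ≠ m u ∧ w ≠ v ∧ w ≠ m v ∧
        PairAdj G m u v ∧ PairAdj G m u w := by
  rintro ⟨v, w, hv, hw, a1, a2, a3, a4, a5, a6, hv1, hw1⟩
  obtain ⟨v', hv', ev⟩ := mem_ext_of_pairAdj G S m hm u v hu hv a1 a2 hv1
  obtain ⟨w', hw', ew⟩ := mem_ext_of_pairAdj G S m hm u w hu hw a3 a4 hw1
  exact rep_ne G S m hm v w v' w' hv hw a5 a6 ev ew (Finset.card_le_one.1 hc v' hv' w' hw')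

theorem no_three (hm : IsMatchingOn G S m) (u : V) (hu : u ∈ S)
    (hc : (extN G S m u ∪ extN G S m (m u)).card ≤ 2) :
    ¬ ∃ v w z : V, v ∈ S ∧ w ∈ S ∧ z ∈ S ∧
        v ≠ u ∧ v ≠ m u ∧ w ≠ u ∧ w ≠ m u ∧ w ≠ v ∧ w ≠ m v ∧
        z ≠ u ∧ z ≠ m u ∧ z ≠ v ∧ z ≠ m v ∧ z ≠ w ∧ z ≠ m w ∧
        PairAdj G m u v ∧ PairAdj G m u w ∧ PairAdj G m u z := by
  rintro ⟨v, w, z, hv, hw, hz, a1, a2, a3, a4, a5, a6, b1, b2, b3, b4, b5, b6, hv1, hw1, hz1⟩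
  obtain ⟨v', hv', ev⟩ := mem_ext_of_pairAdj G S m hm u v hu hv a1 a2 hv1
  obtain ⟨w', hw', ew⟩ := mem_ext_of_pairAdj G S m hm u w hu hw a3 a4 hw1
  obtain ⟨z', hz', ez⟩ := mem_ext_of_pairAdj G S m hm u z hu hz b1 b2 hz1
  have n1 := rep_ne G S m hm v w v' w' hv hw a5 a6 ev ew
  have n2 := rep_ne G S m hm v z v' z' hv hz b3 b4 ev ez
  have n3 := rep_ne G S m hm w z w' z' hw hz b5 b6 ew ez
  have := Finset.two_lt_card.2 ⟨v', hv', w', hw', z', hz', n1, n2, n3⟩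
  omega

/-- the pair graph on a finite set of pairs -/
def pairGraph (P : Finset (Finset V)) : SimpleGraph P where
  Adj p q := p ≠ q ∧ ∃ a ∈ p.1, ∃ b ∈ q.1, G.Adj a b
  symm := ⟨fun _ _ h => ⟨h.1.symm, by
    obtain ⟨a, ha, b, hb, hab⟩ := h.2
    exact ⟨b, hb, a, ha, hab.symm⟩⟩⟩
  loopless := ⟨fun _ h => h.1 rfl⟩

/-- A connected finite graph with all degrees at most two has at most two vertices of degree
at most one. -/
theorem deg_count {W : Type*} [Fintype W] [DecidableEq W] (H : SimpleGraph W) [DecidableRel H.Adj]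
    (hH : H.Connected) (h2 : ∀ w, H.degree w ≤ 2) (K : Finset W)
    (hK : ∀ w ∈ K, H.degree w ≤ 1) : K.card ≤ 2 := by
  have e := hH.card_vert_le_card_edgeSet_add_one
  have hs := H.sum_degrees_eq_twice_card_edges
  have hb : ∑ w, (H.degree w + if w ∈ K then 1 else 0) ≤ ∑ w : W, 2 := by
    apply Finset.sum_le_sum
    intro w _
    split_ifs with hw
    · have := hK w hw; omega
    · have := h2 w; omega
  rw [Finset.sum_add_distrib, hs] at hb
  simp only [Finset.sum_ite_mem, Finset.univ_inter, Finset.sum_const, smul_eq_mul, mul_one,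
    Finset.card_univ] at hb
  rw [Nat.card_eq_fintype_card, Nat.card_eq_fintype_card, ← SimpleGraph.edgeFinset_card] at e
  omega

theorem pair_eq (hm : IsMatchingOn G S m) (u v : V) (hu : u ∈ S)
    (h : v = u ∨ v = m u) : ({v, m v} : Finset V) = {u, m u} := by
  rcases h with rfl | rfl
  · rfl
  · rw [(hm u hu).2.2.2, Finset.pair_comm]

theorem comp_bound (hm : IsMatchingOn G S m)
    (h1 : ∀ u ∈ S, IsBCPair G S m u → (extN G S m u ∪ extN G S m (m u)).card ≤ 1)
    (h2 : ∀ u ∈ S, (extN G S m u ∪ extN G S m (m u)).card ≤ 2)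
    (C : Finset V) (hC : IsComponent G S C) :
    (C ∩ (setB G S m ∪ setC G S m)).card ≤ 4 := by
  classical
  obtain ⟨hCS, hCne, hCconn, hCcl⟩ := hC
  let pr : V → Finset V := fun u => {u, m u}
  let P := C.image pr
  let f : C → P := fun u => ⟨pr u, Finset.mem_image_of_mem _ u.2⟩
  have hf : Function.Surjective f := by
    rintro ⟨p, hp⟩
    obtain ⟨u, hu, rfl⟩ := Finset.mem_image.1 hp
    exact ⟨⟨u, hu⟩, rfl⟩
  let H := pairGraph G P
  have hconnH : H.Connected := by
    have : Nonempty P := ⟨f ⟨hCne.choose, hCne.choose_spec⟩⟩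
    refine ⟨?_⟩
    intro p q
    obtain ⟨u, rfl⟩ := hf p
    obtain ⟨v, rfl⟩ := hf q
    obtain ⟨W⟩ := hCconn.preconnected u v
    induction W with
    | nil => exact SimpleGraph.Reachable.refl _
    | @cons a b c hab _ ih =>
      refine SimpleGraph.Reachable.trans ?_ ih
      by_cases hfe : f a = f b
      · rw [hfe]
      · apply SimpleGraph.Adj.reachable
        exact ⟨hfe, a.1, by simp [f, pr], b.1, by simp [f, pr], hab⟩
  have hne : ∀ u v : C, f v ≠ f u → v.1 ≠ u.1 ∧ v.1 ≠ m u.1 := by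
    intro u v h
    refine ⟨fun e => h ?_, fun e => h ?_⟩
    · exact Subtype.ext (pair_eq G S m hm u v (hCS u.2) (Or.inl e))
    · exact Subtype.ext (pair_eq G S m hm u v (hCS u.2) (Or.inr e))
  have hpa : ∀ u v : C, H.Adj (f u) (f v) → PairAdj G m u v := by
    rintro u v ⟨-, a, ha, b, hb, hab⟩
    simp only [f, pr, Finset.mem_insert, Finset.mem_singleton] at ha hb
    unfold PairAdj
    rcases ha with rfl | rfl <;> rcases hb with rfl | rfl <;> tauto
  have hd2 : ∀ p, H.degree p ≤ 2 := by
    intro p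
    obtain ⟨u, rfl⟩ := hf p
    by_contra hcon
    rw [not_le, ← SimpleGraph.card_neighborFinset_eq_degree, Finset.two_lt_card] at hcon
    obtain ⟨x, hx, y, hy, z, hz, xy, xz, yz⟩ := hcon
    obtain ⟨x, rfl⟩ := hf x
    obtain ⟨y, rfl⟩ := hf y
    obtain ⟨z, rfl⟩ := hf z
    rw [SimpleGraph.mem_neighborFinset] at hx hy hz
    have n1 := hne u x hx.ne'
    have n2 := hne u y hy.ne'
    have n3 := hne u z hz.ne'
    have n4 := hne x y xy.symm
    have n5 := hne x z xz.symm
    have n6 := hne y z yz.symm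
    exact no_three G S m hm u (hCS u.2) (h2 u (hCS u.2))
      ⟨x, y, z, hCS x.2, hCS y.2, hCS z.2, n1.1, n1.2, n2.1, n2.2, n4.1, n4.2,
        n3.1, n3.2, n5.1, n5.2, n6.1, n6.2, hpa _ _ hx, hpa _ _ hy, hpa _ _ hz⟩
  have hd1 : ∀ u : C, IsBCPair G S m u → H.degree (f u) ≤ 1 := by
    intro u hu
    by_contra hcon
    rw [not_le, ← SimpleGraph.card_neighborFinset_eq_degree, Finset.one_lt_card] at hcon
    obtain ⟨x, hx, y, hy, xy⟩ := hcon
    obtain ⟨x, rfl⟩ := hf x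
    obtain ⟨y, rfl⟩ := hf y
    rw [SimpleGraph.mem_neighborFinset] at hx hy
    have n1 := hne u x hx.ne'
    have n2 := hne u y hy.ne'
    have n4 := hne x y xy.symm
    exact no_two G S m hm u (hCS u.2) (h1 u (hCS u.2) hu)
      ⟨x, y, hCS x.2, hCS y.2, n1.1, n1.2, n2.1, n2.2, n4.1, n4.2, hpa _ _ hx, hpa _ _ hy⟩
  let K : Finset P := (Finset.univ.filter (fun u : C => IsBCPair G S m u)).image f
  have hK : K.card ≤ 2 := by
    refine deg_count H hconnH hd2 K ?_
    intro p hp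
    obtain ⟨u, hu, rfl⟩ := Finset.mem_image.1 hp
    exact hd1 u (Finset.mem_filter.1 hu).2
  have hsub : C ∩ (setB G S m ∪ setC G S m) ⊆ K.biUnion (fun p => p.1) := by
    intro u hu
    rw [Finset.mem_inter, Finset.mem_union] at hu
    obtain ⟨huC, hu⟩ := hu
    have huS := hCS huC
    have hbc : IsBCPair G S m u := by
      rcases hu with hu | hu
      · refine Or.inl ⟨hu, ?_⟩
        simp only [setC, Finset.mem_filter]
        rw [(hm u huS).2.2.2]
        exact ⟨(hm u huS).1, hu⟩
      · refine Or.inr ⟨hu, ?_⟩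
        simp only [setC, Finset.mem_filter] at hu
        exact hu.2
    rw [Finset.mem_biUnion]
    refine ⟨f ⟨u, huC⟩, ?_, by simp [f, pr]⟩
    apply Finset.mem_image_of_mem
    simp [hbc]
  have h3 := Finset.card_le_card hsub
  have h4 : (K.biUnion (fun p => p.1)).card ≤ K.card * 2 := by
    apply Finset.card_biUnion_le_card_mul
    intro p _
    obtain ⟨u, rfl⟩ := hf p
    exact Finset.card_le_two
  omega

end helpers

theorem pair_adjacency_bounds {V : Type*} [Fintype V] [DecidableEq V]
    (G : SimpleGraph V) [DecidableRel G.Adj] (S : Finset V) (m : V → V)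
    (hconn : G.Connected)
    (hcubic : ∀ v : V, G.degree v = 3)
    (hdom : ∀ v : V, v ∉ S → ∃ u ∈ S, G.Adj v u)
    (hmatch : IsMatchingOn G S m)
    (hmincard : ∀ T : Finset V, IsPDS G T → S.card ≤ T.card)
    (hP1 : ∀ T : Finset V, IsPDS G T → T.card = S.card → lambdaS G S ≤ lambdaS G T)
    (hP2 : ∀ (T : Finset V) (m' : V → V),
        (∀ v : V, v ∉ T → ∃ u ∈ T, G.Adj v u) → IsMatchingOn G T m' →
        T.card = S.card → lambdaS G T = lambdaS G S →
        (setA G S m ∪ setB G S m).card ≤ (setA G T m' ∪ setB G T m').card) :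
    ((∀ u : V, u ∈ S → IsBCPair G S m u →
      ¬ ∃ v w : V, v ∈ S ∧ w ∈ S ∧
        v ≠ u ∧ v ≠ m u ∧ w ≠ u ∧ w ≠ m u ∧ w ≠ v ∧ w ≠ m v ∧
        PairAdj G m u v ∧ PairAdj G m u w) ∧
    (∀ u : V, u ∈ S → IsAPair G S m u →
      ¬ ∃ v w z : V, v ∈ S ∧ w ∈ S ∧ z ∈ S ∧
        v ≠ u ∧ v ≠ m u ∧ w ≠ u ∧ w ≠ m u ∧ w ≠ v ∧ w ≠ m v ∧
        z ≠ u ∧ z ≠ m u ∧ z ≠ v ∧ z ≠ m v ∧ z ≠ w ∧ z ≠ m w ∧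
        PairAdj G m u v ∧ PairAdj G m u w ∧ PairAdj G m u z)) ∧
    (∀ C : Finset V, IsComponent G S C →
      (C ∩ (setB G S m ∪ setC G S m)).card ≤ 4) := by
  have h1 : ∀ u ∈ S, IsBCPair G S m u → (extN G S m u ∪ extN G S m (m u)).card ≤ 1 :=
    fun u hu h => ext_BC G S m hcubic hdom hmatch hP1 u hu h
  have h2 : ∀ u ∈ S, (extN G S m u ∪ extN G S m (m u)).card ≤ 2 :=
    fun u hu => ext_all G S m hcubic hdom hmatch hmincard hP1 u hu
  refine ⟨⟨?_, ?_⟩, ?_⟩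
  · intro u hu h
    exact no_two G S m hmatch u hu (h1 u hu h)
  · intro u hu _
    exact no_three G S m hmatch u hu (h2 u hu)
  · exact comp_bound G S m hmatch h1 h2
end
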